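/- Under the hypotheses above (φ symplectic with Id − φ invertible, J₁ = φJ₀φ^{-1}), the Gaussian integral satisfies ∫_{ℝ^{2n}} (𝒫₁𝒫₀)(φZ, Z) dZ = det(A₁^0)^{1/2} · det^{-1/2}[(Π_0^1 − φ^{-1}conj(Π_1^0))(Id − φ)], where det^{-1/2} of a complex symmetric matrix with positive definite real part is defined by analytic continuation along t ↦ Re + t·i·Im from the positive branch. -/

import Mathlib

open Matrix MeasureTheory

noncomputable section

/-- Standard complex structure on ℝ^{2n}: J₀ e_{2k} = e_{2k+1}, J₀ e_{2k+1} = -e_{2k}. -/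
def J0 (n : ℕ) : Matrix (Fin (2*n)) (Fin (2*n)) ℝ :=
  Matrix.of fun i j =>
    if (i : ℕ) = (j : ℕ) + 1 ∧ (j : ℕ) % 2 = 0 then 1
    else if (j : ℕ) = (i : ℕ) + 1 ∧ (i : ℕ) % 2 = 0 then -1 else 0

/-- Standard symplectic form Ω(u,v) = ⟨J₀ u, v⟩. -/
def Omega (n : ℕ) (u v : Fin (2*n) → ℝ) : ℝ := (J0 n *ᵥ u) ⬝ᵥ v

/-- A complex structure J compatible with Ω: J² = -Id, Ω is J-invariant,
and ⟨·,·⟩_J := Ω(·, J·) is positive definite. -/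
def Compatible (n : ℕ) (J : Matrix (Fin (2*n)) (Fin (2*n)) ℝ) : Prop :=
  J * J = -1 ∧ (∀ u v, Omega n (J *ᵥ u) (J *ᵥ v) = Omega n u v) ∧
    ∀ v : Fin (2*n) → ℝ, v ≠ 0 → 0 < Omega n v (J *ᵥ v)

/-- Complexification of a real matrix. -/
def mc {m : ℕ} (M : Matrix (Fin m) (Fin m) ℝ) : Matrix (Fin m) (Fin m) ℂ :=
  M.map (fun x => (x : ℂ))

/-- Complexification of a real vector. -/
def vc {m : ℕ} (v : Fin m → ℝ) : Fin m → ℂ := fun i => (v i : ℂ)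

/-- Projection P^{(1,0)} = ½(Id - iK) onto the +i eigenspace of K. -/
def P10 {n : ℕ} (K : Matrix (Fin (2*n)) (Fin (2*n)) ℝ) : Matrix (Fin (2*n)) (Fin (2*n)) ℂ :=
  (1/2 : ℂ) • (1 - Complex.I • mc K)

/-- Projection P^{(0,1)} = ½(Id + iK) onto the -i eigenspace of K. -/
def P01 {n : ℕ} (K : Matrix (Fin (2*n)) (Fin (2*n)) ℝ) : Matrix (Fin (2*n)) (Fin (2*n)) ℂ :=
  (1/2 : ℂ) • (1 + Complex.I • mc K)

/-- `Amat n K J = (½(Id + (-K)·J))⁻¹`; so `Amat n (J0 n) J` is A_t^0 and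
`Amat n J (J0 n)` is A_0^t. -/
def Amat (n : ℕ) (K J : Matrix (Fin (2*n)) (Fin (2*n)) ℝ) : Matrix (Fin (2*n)) (Fin (2*n)) ℝ :=
  ((1/2 : ℝ) • (1 + (-K) * J))⁻¹

/-- Π_t^0 = A_t^0 · P₀^{(1,0)}, the projection onto V_t^{(1,0)} with kernel V₀^{(0,1)}. -/
def PiT0 (n : ℕ) (J : Matrix (Fin (2*n)) (Fin (2*n)) ℝ) : Matrix (Fin (2*n)) (Fin (2*n)) ℂ :=
  mc (Amat n (J0 n) J) * P10 (J0 n)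

/-- Π_0^t = A_0^t · P_t^{(1,0)}, the projection onto V₀^{(1,0)} with kernel V_t^{(0,1)}. -/
def Pi0T (n : ℕ) (J : Matrix (Fin (2*n)) (Fin (2*n)) ℝ) : Matrix (Fin (2*n)) (Fin (2*n)) ℂ :=
  mc (Amat n J (J0 n)) * P10 J

/-- Model Bergman kernel 𝒫_J(Z,Z') = exp(-(π/2)⟨(-J₀J)(Z-Z'),Z-Z'⟩ - πiΩ(Z,Z')). -/
def Pker (n : ℕ) (J : Matrix (Fin (2*n)) (Fin (2*n)) ℝ) (Z Z' : Fin (2*n) → ℝ) : ℂ :=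
  Complex.exp (-(Real.pi : ℂ)/2 * Complex.ofReal ((((-(J0 n)) * J) *ᵥ (Z - Z')) ⬝ᵥ (Z - Z'))
    - (Real.pi : ℂ) * Complex.I * Complex.ofReal (Omega n Z Z'))

/-- Closed formula for the composed kernel (𝒫_t𝒫_0)(Z,Z'). -/
def PtP0form (n : ℕ) (J : Matrix (Fin (2*n)) (Fin (2*n)) ℝ) (Z Z' : Fin (2*n) → ℝ) : ℂ :=
  Complex.ofReal (Real.sqrt (Amat n (J0 n) J).det) *
    Complex.exp (-(Real.pi : ℂ) *
      ((Pi0T n J *ᵥ (vc Z - vc Z')) ⬝ᵥ (vc Z - vc Z')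
        + Complex.I * Complex.ofReal (Omega n Z Z')))

/-- S = (Π_0^1 - φ⁻¹·conj(Π_1^0))(Id - φ), with J₁ = φJ₀φ⁻¹. -/
def Smat (n : ℕ) (φ : Matrix (Fin (2*n)) (Fin (2*n)) ℝ) : Matrix (Fin (2*n)) (Fin (2*n)) ℂ :=
  (Pi0T n (φ * J0 n * φ⁻¹)
      - mc φ⁻¹ * (PiT0 n (φ * J0 n * φ⁻¹)).map (⇑(starRingEnd ℂ))) * (1 - mc φ)

theorem transpose_mul_mul_mulVec_dotProduct {ι : Type*} [Fintype ι] (M N : Matrix ι ι ℝ)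
    (u v : ι → ℝ) : ((Nᵀ * M * N) *ᵥ u) ⬝ᵥ v = (M *ᵥ (N *ᵥ u)) ⬝ᵥ (N *ᵥ v) := by
  rw [dotProduct_mulVec, ← mulVec_transpose]
  simp only [mulVec_mulVec, Matrix.mul_assoc]

open scoped MatrixOrder in
/-- Simultaneous diagonalization by congruence of a positive definite and a symmetric form. -/
theorem exists_congruence_diagonal {ι : Type*} [Fintype ι] [DecidableEq ι]
    {A B : Matrix ι ι ℝ} (hA : A.PosDef) (hB : B.IsSymm) :
    ∃ (C : Matrix ι ι ℝ) (b : ι → ℝ), C.det ≠ 0 ∧ Cᵀ * A * C = 1 ∧ Cᵀ * B * C = diagonal b := by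
  obtain ⟨L, hL⟩ := CStarAlgebra.nonneg_iff_eq_star_mul_self.mp hA.posSemidef.nonneg
  rw [star_eq_conjTranspose, conjTranspose_eq_transpose_of_trivial] at hL
  have hLdet : IsUnit L.det := by
    have h := hA.det_pos.ne'
    rw [hL, det_mul] at h
    exact isUnit_iff_ne_zero.2 (right_ne_zero_of_mul h)
  have hH : (L⁻¹ᵀ * B * L⁻¹).IsHermitian := by
    rw [Matrix.IsHermitian, conjTranspose_eq_transpose_of_trivial]
    simp [transpose_mul, hB.eq, Matrix.mul_assoc]
  set U : Matrix ι ι ℝ := hH.eigenvectorUnitary.1 with hU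
  have hUU : Uᵀ * U = 1 := by
    have := (Matrix.mem_unitaryGroup_iff').1 hH.eigenvectorUnitary.2
    rwa [star_eq_conjTranspose, conjTranspose_eq_transpose_of_trivial] at this
  have hsp : Uᵀ * (L⁻¹ᵀ * B * L⁻¹) * U = diagonal hH.eigenvalues := by
    have h := hH.conjStarAlgAut_star_eigenvectorUnitary
    rw [Unitary.conjStarAlgAut_apply] at h
    simpa [star_eq_conjTranspose, conjTranspose_eq_transpose_of_trivial, Function.comp_def]
      using h
  have hLL : L * L⁻¹ = 1 := mul_nonsing_inv L hLdet
  have hLLt : L⁻¹ᵀ * Lᵀ = 1 := by rw [← transpose_mul, hLL, transpose_one]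
  refine ⟨L⁻¹ * U, hH.eigenvalues, ?_, ?_, ?_⟩
  · rw [det_mul]
    refine mul_ne_zero (fun h => ?_) (fun h => ?_)
    · have := congrArg det hLL
      simp [h] at this
    · have := congrArg det hUU
      simp [h] at this
  · calc (L⁻¹ * U)ᵀ * A * (L⁻¹ * U) = Uᵀ * (L⁻¹ᵀ * Lᵀ) * (L * L⁻¹) * U := by
          rw [hL, transpose_mul]; simp only [Matrix.mul_assoc]
      _ = 1 := by rw [hLL, hLLt]; simpa using hUU
  · rw [← hsp, transpose_mul]; simp only [Matrix.mul_assoc]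

theorem integral_comp_mulVec {ι : Type*} [Fintype ι] [DecidableEq ι] {C : Matrix ι ι ℝ}
    (hC : C.det ≠ 0) (f : (ι → ℝ) → ℂ) :
    ∫ x, f (C *ᵥ x) = ((|C.det|⁻¹ : ℝ) : ℂ) * ∫ x, f x := by
  have hemb : MeasurableEmbedding (toLin' C) :=
    (LinearEquiv.toContinuousLinearEquiv
      (Matrix.toLinearEquiv' C (Matrix.invertibleOfIsUnitDet C
        (isUnit_iff_ne_zero.2 hC)))).toHomeomorph.measurableEmbedding
  have h := hemb.integral_map (μ := volume) f
  rw [Real.map_matrix_volume_pi_eq_smul_volume_pi hC, integral_smul_measure] at h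
  simp only [toLin'_apply] at h
  rw [← h, ENNReal.toReal_ofReal (abs_nonneg _), abs_inv, Complex.real_smul]

/-- The value of a diagonal complex Gaussian integral. -/
theorem integral_cexp_neg_pi_sum {ι : Type*} [Fintype ι] (c : ι → ℂ) (hc : ∀ i, 0 < (c i).re) :
    ∫ x : ι → ℝ, Complex.exp (-(Real.pi : ℂ) * ∑ i, c i * (x i : ℂ) ^ 2)
      = ∏ i, (c i)⁻¹ ^ (2⁻¹ : ℂ) := by
  have h : ∀ x : ι → ℝ, Complex.exp (-(Real.pi : ℂ) * ∑ i, c i * (x i : ℂ) ^ 2)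
      = ∏ i, Complex.exp (-(Real.pi * c i) * (x i : ℂ) ^ 2) := by
    intro x
    rw [← Complex.exp_sum, Finset.mul_sum]
    congr 1
    exact Finset.sum_congr rfl fun i _ => by ring
  simp_rw [h]
  rw [integral_fintype_prod_volume_eq_prod
    (f := fun i (v : ℝ) => Complex.exp (-(Real.pi * c i) * (v : ℂ) ^ 2))]
  refine Finset.prod_congr rfl fun i _ => ?_
  have hpi : (Real.pi : ℂ) ≠ 0 := by exact_mod_cast Real.pi_ne_zero
  rw [integral_gaussian_complex (by simpa using mul_pos Real.pi_pos (hc i)),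
    div_mul_eq_div_div, div_self hpi, one_div, one_div]

/-- Complex Gaussian integral, with the square root of the determinant continued from the real
part. -/
theorem integral_cexp_neg_pi_quadratic {ι : Type*} [Fintype ι] [DecidableEq ι]
    {A B : Matrix ι ι ℝ} (hA : A.PosDef) (hB : B.IsSymm) (σ : ℝ → ℂ)
    (hσ : ContinuousOn σ (Set.Icc 0 1))
    (hσ2 : ∀ t ∈ Set.Icc (0 : ℝ) 1, σ t ^ 2 =
      (A.map (fun x => (x : ℂ)) + (t : ℂ) • (Complex.I • B.map (fun x => (x : ℂ)))).det)
    (hσ0 : σ 0 = Complex.ofReal (Real.sqrt A.det)) :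
    ∫ x : ι → ℝ, Complex.exp (-(Real.pi : ℂ) *
        (((A *ᵥ x) ⬝ᵥ x : ℝ) + Complex.I * ((B *ᵥ x) ⬝ᵥ x : ℝ))) = (σ 1)⁻¹ := by
  obtain ⟨C, b, hC, hCA, hCB⟩ := exists_congruence_diagonal hA hB
  have hC' : ((|C.det| : ℝ) : ℂ) ≠ 0 := by exact_mod_cast abs_ne_zero.2 hC
  set c : ℝ → ι → ℂ := fun t i => 1 + t * (Complex.I * b i) with hc
  have hre : ∀ t i, 0 < (c t i).re := fun t i => by simp [hc]
  have hne : ∀ t i, c t i ≠ 0 := fun t i h => by simpa [h] using hre t i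
  set p : ℝ → ℂ := fun t => ∏ i, (c t i)⁻¹ ^ (2⁻¹ : ℂ) with hp
  have hp2 : ∀ t, p t ^ 2 = (∏ i, c t i)⁻¹ := fun t => by
    rw [hp]
    simp only
    rw [← Finset.prod_pow, ← Finset.prod_inv_distrib]
    refine Finset.prod_congr rfl fun i _ => ?_
    simp
  have hp_ne : ∀ t, p t ≠ 0 := fun t h => by
    have := hp2 t
    rw [h, zero_pow two_ne_zero, eq_comm, inv_eq_zero] at this
    exact Finset.prod_ne_zero_iff.2 (fun i _ => hne t i) this
  have hpc : Continuous p := by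
    refine continuous_finsetProd _ fun i _ => ?_
    have hci : Continuous fun t => (c t i)⁻¹ :=
      Continuous.inv₀ (by simp only [hc]; fun_prop) (fun t => hne t i)
    refine hci.cpow continuous_const fun t => Or.inl ?_
    rw [Complex.inv_re]
    exact div_pos (hre t i) (Complex.normSq_pos.2 (hne t i))
  have hdet : ∀ t : ℝ,
      (A.map (fun x => (x : ℂ)) + (t : ℂ) • (Complex.I • B.map (fun x => (x : ℂ)))).det
        = (((|C.det| : ℝ) : ℂ)⁻¹) ^ 2 * ∏ i, c t i := by
    intro t
    have h1 : (C.map (fun x => (x : ℂ)))ᵀ *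
        (A.map (fun x => (x : ℂ)) + (t : ℂ) • (Complex.I • B.map (fun x => (x : ℂ)))) *
        C.map (fun x => (x : ℂ)) = diagonal (c t) := by
      have hm : ∀ M N : Matrix ι ι ℝ, (M * N).map (fun x => (x : ℂ))
          = M.map (fun x => (x : ℂ)) * N.map (fun x => (x : ℂ)) := fun M N =>
        Matrix.map_mul (f := Complex.ofRealHom)
      have hA' := congrArg (fun M : Matrix ι ι ℝ => M.map (fun x => (x : ℂ))) hCA
      have hB' := congrArg (fun M : Matrix ι ι ℝ => M.map (fun x => (x : ℂ))) hCB
      simp only [hm, transpose_map] at hA' hB'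
      rw [Matrix.mul_add, Matrix.add_mul, hA', Matrix.mul_smul, Matrix.mul_smul, Matrix.smul_mul,
        Matrix.smul_mul, hB']
      ext i j
      by_cases hij : i = j
      · subst hij; simp [hc]
      · simp [hij]
    have h2 := congrArg det h1
    have h3 : (C.map (fun x => (x : ℂ))).det = (C.det : ℂ) :=
      ((Complex.ofRealHom).map_det C).symm
    rw [det_mul, det_mul, det_transpose, det_diagonal, h3] at h2
    rw [← h2]
    have h4 : ((|C.det| : ℝ) : ℂ) ^ 2 = (C.det : ℂ) ^ 2 := by exact_mod_cast sq_abs C.det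
    have h5 : (C.det : ℂ) ≠ 0 := by exact_mod_cast hC
    rw [inv_pow, h4]
    field_simp
  have hσ1 : σ 1 = ((|C.det| : ℝ) : ℂ)⁻¹ * (p 1)⁻¹ := by
    refine isPreconnected_Icc.eq_of_sq_eq (g := fun t => ((|C.det| : ℝ) : ℂ)⁻¹ * (p t)⁻¹) hσ
      ((continuous_const.mul (hpc.inv₀ hp_ne)).continuousOn) ?_
      (fun _ => mul_ne_zero (inv_ne_zero hC') (inv_ne_zero (hp_ne _)))
      (Set.left_mem_Icc.2 zero_le_one) ?_ (Set.right_mem_Icc.2 zero_le_one)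
    · intro t ht
      simp only [Pi.pow_apply]
      rw [hσ2 t ht, hdet, mul_pow, inv_pow (p t), hp2, inv_inv]
    · have hA1 : A.det = (|C.det|⁻¹) ^ 2 := by
        have h := congrArg det hCA
        rw [det_mul, det_mul, det_transpose, det_one] at h
        rw [inv_pow, sq_abs]
        field_simp
        linarith
      rw [hσ0, hA1, Real.sqrt_sq (inv_nonneg.2 (abs_nonneg _))]
      simp [hp, hc]
  have hint : ∫ x : ι → ℝ, Complex.exp (-(Real.pi : ℂ) *
        (((A *ᵥ (C *ᵥ x)) ⬝ᵥ (C *ᵥ x) : ℝ) + Complex.I * ((B *ᵥ (C *ᵥ x)) ⬝ᵥ (C *ᵥ x) : ℝ)))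
      = p 1 := by
    rw [hp]
    simp only
    rw [← integral_cexp_neg_pi_sum (c 1) (hre 1)]
    congr 1
    ext x
    rw [← transpose_mul_mul_mulVec_dotProduct, ← transpose_mul_mul_mulVec_dotProduct, hCA, hCB]
    congr 2
    simp only [one_mulVec, mulVec_diagonal, dotProduct, Complex.ofReal_sum, Finset.mul_sum,
      ← Finset.sum_add_distrib, hc]
    refine Finset.sum_congr rfl fun i _ => ?_
    push_cast
    ring
  rw [integral_comp_mulVec hC (fun y => Complex.exp (-(Real.pi : ℂ) *
        (((A *ᵥ y) ⬝ᵥ y : ℝ) + Complex.I * ((B *ᵥ y) ⬝ᵥ y : ℝ))))] at hint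
  rw [hσ1, ← hint]
  push_cast
  field_simp

theorem dotProduct_mulVec_self_of_skew {ι : Type*} [Fintype ι] {M : Matrix ι ι ℝ}
    (hM : Mᵀ = -M) (v : ι → ℝ) : (M *ᵥ v) ⬝ᵥ v = 0 := by
  have h : (M *ᵥ v) ⬝ᵥ v = -((M *ᵥ v) ⬝ᵥ v) := by
    conv_lhs => rw [dotProduct_comm, dotProduct_mulVec, ← mulVec_transpose, hM, neg_mulVec,
      neg_dotProduct]
  linarith

theorem eq_of_forall_mulVec_dotProduct {ι : Type*} [Fintype ι] [DecidableEq ι]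
    {M N : Matrix ι ι ℝ} (h : ∀ u v, (M *ᵥ u) ⬝ᵥ v = (N *ᵥ u) ⬝ᵥ v) : M = N := by
  ext i j
  simpa using h (Pi.single j 1) (Pi.single i 1)

theorem J0_transpose (n : ℕ) : (J0 n)ᵀ = -J0 n := by
  ext i j
  simp only [J0, transpose_apply, of_apply, Matrix.neg_apply]
  split_ifs <;> first | omega | simp

/-- The matrix `R = (1 - J₀J)⁻¹` attached to a compatible structure `J = φJ₀φ⁻¹`, where `φ` is
symplectic, with the relations it satisfies. -/
theorem exists_resolvent {n : ℕ} {φ : Matrix (Fin (2*n)) (Fin (2*n)) ℝ}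
    (hsymp : ∀ u v, Omega n (φ *ᵥ u) (φ *ᵥ v) = Omega n u v)
    (hJ : Compatible n (φ * J0 n * φ⁻¹)) :
    φ⁻¹ * φ = 1 ∧ φᵀ * J0 n = J0 n * φ⁻¹ ∧ ∃ R : Matrix (Fin (2*n)) (Fin (2*n)) ℝ,
      Rᵀ = R ∧ (1 - R).PosDef ∧ R * J0 n + J0 n * R = J0 n ∧
      (1 - R) * (φ * J0 n * φ⁻¹) = R * J0 n ∧ φᵀ * (1 - R) = φ⁻¹ * R ∧
      φᵀ * (R * J0 n) = J0 n * φ⁻¹ - φ⁻¹ * (R * J0 n) ∧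
      Amat n (J0 n) (φ * J0 n * φ⁻¹) = (2 : ℝ) • R ∧
      Amat n (φ * J0 n * φ⁻¹) (J0 n) = (2 : ℝ) • (1 - R) := by
  obtain ⟨hJJ, hJinv, hJpos⟩ := hJ
  have hKt := J0_transpose n
  set K := J0 n with hK
  have hφ : φᵀ * K * φ = K := eq_of_forall_mulVec_dotProduct fun u v => by
    rw [transpose_mul_mul_mulVec_dotProduct]
    exact hsymp u v
  have hJK : (φ * K * φ⁻¹)ᵀ * K * (φ * K * φ⁻¹) = K :=
    eq_of_forall_mulVec_dotProduct fun u v => by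
      rw [transpose_mul_mul_mulVec_dotProduct]
      exact hJinv u v
  have hKdet : IsUnit K := by
    rw [← mulVec_injective_iff_isUnit]
    refine (injective_iff_map_eq_zero' (mulVecLin K)).2 fun v => ⟨fun h => ?_, ?_⟩
    · by_contra hv
      have := hJpos v hv
      rw [Omega, ← hK, ← mulVecLin_apply, h, zero_dotProduct] at this
      exact lt_irrefl _ this
    · rintro rfl; simp
  have hφdet : IsUnit φ.det := by
    have h := congrArg det hφ
    rw [det_mul, det_mul, det_transpose] at h
    have hK0 := ((isUnit_iff_isUnit_det K).1 hKdet).ne_zero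
    refine isUnit_iff_ne_zero.2 fun h0 => hK0 ?_
    rw [← h, h0]; ring
  have h1 : φ * φ⁻¹ = 1 := mul_nonsing_inv _ hφdet
  have h2 : φ⁻¹ * φ = 1 := nonsing_inv_mul _ hφdet
  set ψ := φ⁻¹
  set J := φ * K * ψ with hJdef
  have hψJ : ψ * J = K * ψ := by
    rw [hJdef]
    linear_combination (norm := noncomm_ring) h2 * K * ψ
  have hKK : K * K = -1 := by
    have h : K = ψ * J * φ := by rw [hψJ, Matrix.mul_assoc, h2, Matrix.mul_one]
    calc K * K = K * (ψ * J * φ) := by rw [← h]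
      _ = (K * ψ) * J * φ := by noncomm_ring
      _ = ψ * (J * J) * φ := by rw [← hψJ]; noncomm_ring
      _ = -1 := by rw [hJJ, Matrix.mul_neg, Matrix.mul_one, Matrix.neg_mul, h2]
  have hφtK : φᵀ * K = K * ψ := by
    calc φᵀ * K = φᵀ * K * φ * ψ := by rw [Matrix.mul_assoc (φᵀ * K), h1, Matrix.mul_one]
      _ = K * ψ := by rw [hφ]
  have hφt : φᵀ = -(K * ψ * K) := by
    linear_combination (norm := noncomm_ring) φᵀ * hKK - hφtK * K
  have hJt : Jᵀ * K = -(K * J) := by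
    linear_combination (norm := noncomm_ring) -(hJK * J) + Jᵀ * K * hJJ
  set G := -K * J with hG
  have hJG : J = K * G := by
    rw [hG]; linear_combination (norm := noncomm_ring) hKK * J
  have hGt : Gᵀ = G := by
    rw [hG, transpose_mul, transpose_neg, hKt, neg_neg, hJt, Matrix.neg_mul]
  have hGJ : G * J = K := by
    rw [hG]; linear_combination (norm := noncomm_ring) -K * hJJ
  have hGKG : G * K * G = K := by rw [Matrix.mul_assoc, ← hJG, hGJ]
  have hGpos : G.PosDef := by
    refine .of_dotProduct_mulVec_pos ?_ fun v hv => ?_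
    · rwa [Matrix.IsHermitian, conjTranspose_eq_transpose_of_trivial]
    · have h := hJpos v hv
      rw [Omega, ← hK, dotProduct_comm, dotProduct_mulVec, ← mulVec_transpose, hKt,
        mulVec_mulVec, dotProduct_comm] at h
      simpa [hG] using h
  have h1G : (1 + G).PosDef := Matrix.PosDef.one.add hGpos
  have hdet : IsUnit (1 + G).det := isUnit_iff_ne_zero.2 h1G.det_pos.ne'
  set R := (1 + G)⁻¹ with hR
  have hR1 : R * (1 + G) = 1 := nonsing_inv_mul _ hdet
  have hR2 : (1 + G) * R = 1 := mul_nonsing_inv _ hdet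
  have hRt : Rᵀ = R := by
    rw [hR, transpose_nonsing_inv, transpose_add, transpose_one, hGt]
  have hGR : G * R = 1 - R := by linear_combination (norm := noncomm_ring) hR2
  have hRG : R * G = 1 - R := by linear_combination (norm := noncomm_ring) hR1
  have hRK : R * K + K * R = K := by
    have h : (1 + G) * (R * K + K * R) * (1 + G) = (1 + G) * K * (1 + G) := by
      linear_combination (norm := noncomm_ring)
        hR2 * K * (1 + G) + (1 + G) * K * hR1 - hGKG
    calc R * K + K * R = (R * (1 + G)) * (R * K + K * R) * ((1 + G) * R) := by
          rw [hR1, hR2]; noncomm_ring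
      _ = R * ((1 + G) * (R * K + K * R) * (1 + G)) * R := by noncomm_ring
      _ = (R * (1 + G)) * K * ((1 + G) * R) := by rw [h]; noncomm_ring
      _ = K := by rw [hR1, hR2]; noncomm_ring
  have hJR : J * R = R * K := by
    rw [hJG]
    linear_combination (norm := noncomm_ring) K * hGR - hRK
  refine ⟨h2, hφtK, R, hRt, ?_, hRK, ?_, ?_, ?_, ?_, ?_⟩
  · have hpos : (R * (G + Gᴴ * G) * Rᴴ).PosDef := by
      refine (hGpos.add_posSemidef (posSemidef_conjTranspose_mul_self G)).mul_mul_conjTranspose_same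
        ?_
      exact vecMul_injective_of_isUnit ((isUnit_iff_isUnit_det _).2
        (isUnit_nonsing_inv_det _ hdet))
    rw [conjTranspose_eq_transpose_of_trivial, conjTranspose_eq_transpose_of_trivial, hRt,
      hGt] at hpos
    convert hpos using 1
    linear_combination (norm := noncomm_ring) -hRG - R * G * hR2
  · linear_combination (norm := noncomm_ring) -hRG * J + R * hGJ
  · rw [hφt]
    linear_combination (norm := noncomm_ring)
      K * ψ * hRK + hψJ * R * K - ψ * hJR * K - ψ * R * hKK
  · rw [hφt]
    linear_combination (norm := noncomm_ring)
      - K * ψ * hRK * K + K * ψ * R * hKK - K * ψ * hKK + hψJ * R - ψ * hJR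
  · refine inv_eq_right_inv ?_
    rw [← hG, Matrix.smul_mul, Matrix.mul_smul, hR2, smul_smul]
    norm_num
  · refine inv_eq_right_inv ?_
    rw [Matrix.smul_mul, Matrix.mul_smul, smul_smul]
    have : (1 + -J * K) * (1 - R) = 1 := by
      linear_combination (norm := noncomm_ring) J * hRK - hJR * K - R * hKK
    rw [this]; norm_num

theorem mc_mulVec_vc {m : ℕ} (M : Matrix (Fin m) (Fin m) ℝ) (v : Fin m → ℝ) :
    mc M *ᵥ vc v = vc (M *ᵥ v) := by
  ext i
  simp [mc, vc, mulVec, dotProduct]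

theorem vc_dotProduct_vc {m : ℕ} (u v : Fin m → ℝ) : vc u ⬝ᵥ vc v = ((u ⬝ᵥ v : ℝ) : ℂ) := by
  simp [vc, dotProduct]

theorem mc_mul {m : ℕ} (M N : Matrix (Fin m) (Fin m) ℝ) : mc (M * N) = mc M * mc N :=
  Matrix.map_mul (f := Complex.ofRealHom)

theorem mc_sub {m : ℕ} (M N : Matrix (Fin m) (Fin m) ℝ) : mc (M - N) = mc M - mc N := by
  ext; simp [mc]

theorem mc_one {m : ℕ} : mc (1 : Matrix (Fin m) (Fin m) ℝ) = 1 := by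
  simp [mc]

/-- Twice a real matrix times `P^{(1,0)}`. -/
theorem mc_two_smul_mul_P10 {n : ℕ} (M K : Matrix (Fin (2*n)) (Fin (2*n)) ℝ) :
    mc ((2 : ℝ) • M) * P10 K = mc M - Complex.I • mc (M * K) := by
  have h : mc ((2 : ℝ) • M) = (2 : ℂ) • mc M := by ext; simp [mc]
  rw [h, P10, Matrix.smul_mul, Matrix.mul_smul, smul_smul, Matrix.mul_sub, Matrix.mul_one,
    Matrix.mul_smul, mc_mul]
  norm_num

/-- ∫ (𝒫₁𝒫₀)(φZ,Z)dZ = det(A₁^0)^{1/2}·det^{-1/2}(S), where det^{1/2}(S)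
is defined by analytic continuation of the positive square root along
t ↦ Re S + t·i·Im S, encoded by a continuous square-root path σ. -/
theorem stmt12 (n : ℕ) (φ : Matrix (Fin (2*n)) (Fin (2*n)) ℝ)
    (hsymp : ∀ u v, Omega n (φ *ᵥ u) (φ *ᵥ v) = Omega n u v)
    (hJ1 : Compatible n (φ * J0 n * φ⁻¹))
    (hinv : IsUnit (1 - φ)) :
    ∀ σ : ℝ → ℂ, ContinuousOn σ (Set.Icc 0 1) →
      (∀ t ∈ Set.Icc (0:ℝ) 1,
        σ t ^ 2 = (((Smat n φ).map Complex.re).map (fun x => (x : ℂ))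
            + (t : ℂ) • (Complex.I • ((Smat n φ).map Complex.im).map (fun x => (x : ℂ)))).det) →
      σ 0 = Complex.ofReal (Real.sqrt (((Smat n φ).map Complex.re).det)) →
      ∫ Z : Fin (2*n) → ℝ, PtP0form n (φ * J0 n * φ⁻¹) (φ *ᵥ Z) Z
        = Complex.ofReal (Real.sqrt ((Amat n (J0 n) (φ * J0 n * φ⁻¹)).det)) * (σ 1)⁻¹ := by
  intro σ hσ hσ2 hσ0
  obtain ⟨hψφ, hφtK, R, hRt, hRpos, hRK, hRJ, hφR, hφRK, hA1, hA2⟩ := exists_resolvent hsymp hJ1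
  have hKt := J0_transpose n
  set K := J0 n with hK
  set J := φ * K * φ⁻¹
  set ψ := φ⁻¹
  have hPi0 : Pi0T n J = mc (1 - R) - Complex.I • mc (R * K) := by
    rw [Pi0T, hA2, mc_two_smul_mul_P10, hRJ]
  have hPiT : (PiT0 n J).map (starRingEnd ℂ) = mc R + Complex.I • mc (R * K) := by
    rw [PiT0, hA1, mc_two_smul_mul_P10]
    ext i j
    simp [mc, hK]
  set A := (1 - R - ψ * R) * (1 - φ) with hA
  set B := (-(R * K) - ψ * (R * K)) * (1 - φ) with hB
  have hS : Smat n φ = mc A + Complex.I • mc B := by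
    change (Pi0T n J - mc ψ * (PiT0 n J).map (starRingEnd ℂ)) * (1 - mc φ) = _
    rw [hPi0, hPiT, hA, hB]
    have hneg : mc (-(R * K) - ψ * (R * K)) = -mc (R * K) - mc ψ * mc (R * K) := by
      rw [← mc_mul]; ext; simp [mc]
    rw [mc_mul (1 - R - ψ * R), mc_mul (-(R * K) - ψ * (R * K)), hneg, mc_sub (1 - R),
      mc_mul ψ R, mc_sub 1 φ, mc_one, ← Matrix.smul_mul,
      ← Matrix.add_mul]
    congr 1
    simp only [Matrix.mul_add, Matrix.mul_smul, smul_sub, smul_neg]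
    abel
  have hSre : (Smat n φ).map Complex.re = A := by
    rw [hS]; ext i j; simp [mc]
  have hSim : (Smat n φ).map Complex.im = B := by
    rw [hS]; ext i j; simp [mc]
  rw [hSre, hSim] at hσ2
  rw [hSre] at hσ0
  have hNt : (1 - φ)ᵀ = 1 - φᵀ := by simp
  have hAN : A = (1 - φ)ᵀ * (1 - R) * (1 - φ) := by
    rw [hA, hNt]
    linear_combination (norm := noncomm_ring) hφR * (1 - φ)
  have hBN : B = -((1 - φ)ᵀ * (R * K) * (1 - φ)) + K - K * ψ := by
    rw [hB, hNt]
    linear_combination (norm := noncomm_ring) -hφRK * (1 - φ) + K * hψφ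
  have hψtK : ψᵀ * K = K * φ := by
    have h := congrArg transpose hφtK
    simpa [hKt, transpose_mul] using h.symm
  have hApos : A.PosDef := by
    rw [hAN, ← conjTranspose_eq_transpose_of_trivial]
    exact hRpos.conjTranspose_mul_mul_same (mulVec_injective_of_isUnit hinv)
  have hBsymm : B.IsSymm := by
    rw [Matrix.IsSymm, hBN]
    simp only [transpose_add, transpose_sub, transpose_neg, transpose_mul, transpose_transpose,
      hKt, hRt, transpose_one]
    linear_combination (norm := noncomm_ring)
      (1 - φᵀ) * hRK * (1 - φ) + hψtK - hφtK + hφtK * φ + K * hψφ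
  have hskew : (K * φ + K * ψ - K)ᵀ = -(K * φ + K * ψ - K) := by
    simp only [transpose_add, transpose_sub, transpose_mul, hKt]
    linear_combination (norm := noncomm_ring) -hφtK - hψtK
  have hint : ∀ Z : Fin (2*n) → ℝ, PtP0form n J (φ *ᵥ Z) Z =
      Complex.ofReal (Real.sqrt ((Amat n K J).det)) * Complex.exp (-(Real.pi : ℂ) *
        (((A *ᵥ Z) ⬝ᵥ Z : ℝ) + Complex.I * ((B *ᵥ Z) ⬝ᵥ Z : ℝ))) := by
    intro Z
    have hv : vc (φ *ᵥ Z) - vc Z = -vc ((1 - φ) *ᵥ Z) := by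
      ext i; simp [vc, sub_mulVec]
    have hBq : (B *ᵥ Z) ⬝ᵥ Z =
        -((R * K) *ᵥ ((1 - φ) *ᵥ Z)) ⬝ᵥ ((1 - φ) *ᵥ Z) + (K *ᵥ (φ *ᵥ Z)) ⬝ᵥ Z := by
      have h := dotProduct_mulVec_self_of_skew hskew Z
      have hBK : B = -((1 - φ)ᵀ * (R * K) * (1 - φ)) + K * φ - (K * φ + K * ψ - K) := by
        rw [hBN]; abel
      rw [hBK, sub_mulVec, sub_dotProduct, h, add_mulVec, add_dotProduct, neg_mulVec,
        neg_dotProduct, transpose_mul_mul_mulVec_dotProduct, mulVec_mulVec Z K φ, sub_zero,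
        neg_dotProduct]
    rw [PtP0form, hPi0, hv, hBq, hAN, transpose_mul_mul_mulVec_dotProduct, Omega, ← hK,
      sub_mulVec, smul_mulVec, mulVec_neg, mulVec_neg, mc_mulVec_vc, mc_mulVec_vc, sub_dotProduct,
      smul_dotProduct, neg_dotProduct_neg, neg_dotProduct_neg, vc_dotProduct_vc, vc_dotProduct_vc]
    congr 2
    simp only [neg_dotProduct, smul_eq_mul]
    push_cast
    ring
  simp_rw [hint]
  rw [integral_const_mul, integral_cexp_neg_pi_quadratic hApos hBsymm σ hσ hσ2 hσ0]

end
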